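/- Run IR-PRM⁺ on the simplex Δ(n) with any utilities u^(t) and predictions m^(t). Then for every t ≥ 1: (i) ‖r̃^(t+1)‖₂ ≥ ‖r̃^(t)‖₂ (the ℓ₂ norm of the regret vector is nondecreasing), and (ii) ‖r̃^(t+1)‖₂² ≤ ‖r̃^(t)‖₂² + ‖g^(t)‖₂²; consequently, for every T, ‖r̃^(T+1)‖₂² ≤ ‖r̃^(1)‖₂² + Σ_{t=1}^T ‖g^(t)‖₂². -/

import Mathlib

open Matrix

/-- ℓ₂ norm of a vector in ℝ^d. -/
noncomputable def l2 {d : ℕ} (v : Fin d → ℝ) : ℝ := Real.sqrt (∑ i, (v i) ^ 2)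

/-- ℓ₁ norm of a vector in ℝ^d. -/
def l1 {d : ℕ} (v : Fin d → ℝ) : ℝ := ∑ i, |v i|

/-- Standard inner product on ℝ^d. -/
def dotp {d : ℕ} (v w : Fin d → ℝ) : ℝ := ∑ i, v i * w i

/-- Coordinatewise positive part `[v]⁺`. -/
def ppart {d : ℕ} (v : Fin d → ℝ) : Fin d → ℝ := fun i => max (v i) 0

/-- A run of the IR-PRM⁺ algorithm on the simplex `Δ(n)`, with utilities `u`,
predictions `m`, regret vectors `rt` (`r̃`) and `r`, normalization constants
`gam` (`γ`), and strategies `x`, `xt` (`x̃`); `g` is the shifted utility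
increment.  All quantities are indexed starting from time `1`. -/
structure IRPRMp (n : ℕ) where
  u : ℕ → Fin n → ℝ
  m : ℕ → Fin n → ℝ
  rt : ℕ → Fin n → ℝ
  gam : ℕ → ℝ
  r : ℕ → Fin n → ℝ
  x : ℕ → Fin n → ℝ
  xt : ℕ → Fin n → ℝ
  g : ℕ → Fin n → ℝ
  rt1_nonneg : ∀ i, 0 ≤ rt 1 i
  xt1_mem : rt 1 = 0 → xt 1 ∈ stdSimplex ℝ (Fin n)
  xt1_eq : rt 1 ≠ 0 → xt 1 = (l1 (rt 1))⁻¹ • rt 1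
  zero_case : ∀ t, 1 ≤ t → rt t = 0 →
      m t = 0 ∧ gam t = 0 ∧ r t = 0 ∧ x t = xt t
  gam_spec : ∀ t, 1 ≤ t → rt t ≠ 0 →
      l2 (ppart (rt t + m t - gam t • (1 : Fin n → ℝ))) = l2 (rt t)
  r_def : ∀ t, 1 ≤ t → rt t ≠ 0 →
      r t = rt t + m t - gam t • (1 : Fin n → ℝ)
  x_def : ∀ t, 1 ≤ t → rt t ≠ 0 →
      x t = (l1 (ppart (r t)))⁻¹ • ppart (r t)
  g_def : ∀ t, 1 ≤ t →
      g t = u t - m t - (dotp (u t - m t) (x t)) • (1 : Fin n → ℝ)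
  rt_succ : ∀ t, 1 ≤ t → rt (t + 1) = ppart (r t + g t)
  xt_succ_ne : ∀ t, 1 ≤ t → rt (t + 1) ≠ 0 →
      xt (t + 1) = (l1 (rt (t + 1)))⁻¹ • rt (t + 1)
  xt_succ_zero : ∀ t, 1 ≤ t → rt (t + 1) = 0 → xt (t + 1) = x t

lemma sum_ppart_mul_sub_eq_zero {d : ℕ} (r w x : Fin d → ℝ)
    (hx : ppart r = 0 ∨ x = (l1 (ppart r))⁻¹ • ppart r) :
    ∑ i, ppart r i * (w - dotp w x • (1 : Fin d → ℝ)) i = 0 := by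
  by_cases hp : ppart r = 0
  · simp [hp]
  have hx := hx.resolve_left hp
  have hnn : ∀ i, 0 ≤ ppart r i := fun i => le_max_right _ _
  have hl : l1 (ppart r) = ∑ i, ppart r i :=
    Finset.sum_congr rfl fun i _ => abs_of_nonneg (hnn i)
  have hS : ∑ i, ppart r i ≠ 0 := by
    intro h
    rw [Finset.sum_eq_zero_iff_of_nonneg fun i _ => hnn i] at h
    exact hp (funext fun i => h i (Finset.mem_univ i))
  have hdot : dotp w x = (∑ i, ppart r i)⁻¹ * ∑ i, ppart r i * w i := by
    rw [hx, hl, dotp, Finset.mul_sum]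
    refine Finset.sum_congr rfl fun i _ => ?_
    simp only [Pi.smul_apply, smul_eq_mul]
    ring
  simp only [Pi.sub_apply, Pi.smul_apply, Pi.one_apply, smul_eq_mul, mul_one, mul_sub,
    Finset.sum_sub_distrib, ← Finset.sum_mul]
  rw [hdot, mul_inv_cancel_left₀ hS, sub_self]

lemma l2_sq {d : ℕ} (v : Fin d → ℝ) : l2 v ^ 2 = ∑ i, v i ^ 2 :=
  Real.sq_sqrt (Finset.sum_nonneg fun _ _ => sq_nonneg _)

lemma l2_ppart_le_l2_ppart_add {d : ℕ} (r g : Fin d → ℝ)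
    (h : ∑ i, ppart r i * g i = 0) : l2 (ppart r) ≤ l2 (ppart (r + g)) := by
  refine Real.sqrt_le_sqrt ?_
  have key : ∑ i, (ppart r i ^ 2 + 2 * (ppart r i * g i)) ≤ ∑ i, ppart (r + g) i ^ 2 := by
    refine Finset.sum_le_sum fun i _ => ?_
    simp only [ppart, Pi.add_apply]
    rcases max_cases (r i) 0 with ⟨h1, h2⟩ | ⟨h1, h2⟩ <;>
      rcases max_cases (r i + g i) 0 with ⟨h3, h4⟩ | ⟨h3, h4⟩ <;> rw [h1, h3] <;> nlinarith [sq_nonneg (g i)]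
  rw [Finset.sum_add_distrib, ← Finset.mul_sum, h] at key
  simpa using key

lemma l2_ppart_add_sq_le {d : ℕ} (r g : Fin d → ℝ)
    (h : ∑ i, ppart r i * g i = 0) :
    l2 (ppart (r + g)) ^ 2 ≤ l2 (ppart r) ^ 2 + l2 g ^ 2 := by
  simp only [l2_sq]
  have key : ∑ i, ppart (r + g) i ^ 2 ≤
      ∑ i, (ppart r i ^ 2 + 2 * (ppart r i * g i) + g i ^ 2) := by
    refine Finset.sum_le_sum fun i _ => ?_
    simp only [ppart, Pi.add_apply]
    rcases max_cases (r i) 0 with ⟨h1, h2⟩ | ⟨h1, h2⟩ <;>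
      rcases max_cases (r i + g i) 0 with ⟨h3, h4⟩ | ⟨h3, h4⟩ <;> rw [h1, h3] <;> nlinarith [sq_nonneg (g i)]
  rw [Finset.sum_add_distrib, Finset.sum_add_distrib, ← Finset.mul_sum, h] at key
  simpa using key

lemma IRPRMp.l2_ppart_r {n : ℕ} (alg : IRPRMp n) {t : ℕ} (ht : 1 ≤ t) :
    l2 (ppart (alg.r t)) = l2 (alg.rt t) := by
  by_cases h0 : alg.rt t = 0
  · rw [(alg.zero_case t ht h0).2.2.1, h0]
    simp [l2, ppart]
  · rw [alg.r_def t ht h0, alg.gam_spec t ht h0]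

lemma IRPRMp.sum_ppart_r_mul_g {n : ℕ} (alg : IRPRMp n) {t : ℕ} (ht : 1 ≤ t) :
    ∑ i, ppart (alg.r t) i * alg.g t i = 0 := by
  rw [alg.g_def t ht]
  refine sum_ppart_mul_sub_eq_zero _ _ _ ?_
  by_cases h0 : alg.rt t = 0
  · left
    rw [(alg.zero_case t ht h0).2.2.1]
    ext i
    simp [ppart]
  · exact Or.inr (alg.x_def t ht h0)

/-- along any run of IR-PRM⁺, the ℓ₂ norm of the regret vector is
nondecreasing, increases by at most `‖g^(t)‖₂²` in square per step, and hence
`‖r̃^(T+1)‖₂² ≤ ‖r̃^(1)‖₂² + ∑_{t=1}^T ‖g^(t)‖₂²`. -/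
theorem stmt10 {n : ℕ} (alg : IRPRMp n) :
    (∀ t, 1 ≤ t →
        l2 (alg.rt t) ≤ l2 (alg.rt (t + 1)) ∧
        (l2 (alg.rt (t + 1))) ^ 2 ≤ (l2 (alg.rt t)) ^ 2 + (l2 (alg.g t)) ^ 2)
    ∧ ∀ T : ℕ, (l2 (alg.rt (T + 1))) ^ 2
        ≤ (l2 (alg.rt 1)) ^ 2 + ∑ t ∈ Finset.Icc 1 T, (l2 (alg.g t)) ^ 2 := by
  have step : ∀ t, 1 ≤ t →
      l2 (alg.rt t) ≤ l2 (alg.rt (t + 1)) ∧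
      (l2 (alg.rt (t + 1))) ^ 2 ≤ (l2 (alg.rt t)) ^ 2 + (l2 (alg.g t)) ^ 2 := by
    intro t ht
    have h := alg.sum_ppart_r_mul_g ht
    rw [alg.rt_succ t ht, ← alg.l2_ppart_r ht]
    exact ⟨l2_ppart_le_l2_ppart_add _ _ h, l2_ppart_add_sq_le _ _ h⟩
  refine ⟨step, fun T => ?_⟩
  induction T with
  | zero => simp
  | succ T ih =>
    rw [Finset.sum_Icc_succ_top (Nat.le_add_left 1 T)]
    linarith [(step (T + 1) (Nat.le_add_left 1 T)).2]
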